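/- arXiv:2510.22762 — 2 statements merged into one kernel-verified Lean document; each statement's English description precedes it below -/
import Mathlib

section
/- For an odd prime p with p ≡ 1 mod 4, the quadratic Gauss sum of the Legendre symbol mod p equals √p; that is, ∑_{k=0}^{p-1} (k/p) e^{2πik/p} = √p. -/
open Complex Finset Real

lemma abel_antitone (w B : ℕ → ℝ) (hB : ∀ r, -1 ≤ B r) (a : ℕ) (c : ℕ) (hac : a ≤ c)
    (hw0 : 0 ≤ w (a+1)) (hB1 : B a ≤ 1)
    (hw : ∀ r, a + 1 ≤ r → r < c + 1 → w (r+1) ≤ w r) :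
    w (c+1) * (1 + B (c+1)) - 2 * w (a+1) ≤ ∑ r ∈ Finset.Ico a (c+1), w (r+1) * (B (r+1) - B r) := by
  induction c, hac using Nat.le_induction with
  | base => simp; nlinarith
  | succ c hac ih =>
    have ih := ih (fun r h1 h2 => hw r h1 (by omega))
    rw [Finset.sum_Ico_succ_top (by omega)]
    have := hw (c+1) (by omega) (by omega)
    have := hB (c+1)
    nlinarith

lemma abel_monotone (w B : ℕ → ℝ) (hB : ∀ r, B r ≤ 1) (a : ℕ) (c : ℕ) (hac : a ≤ c)
    (hw : ∀ r, a + 1 ≤ r → r < c + 1 → w r ≤ w (r+1)) :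
    w (a+1) * (1 - B a) - w (c+1) * (1 - B (c+1)) ≤ ∑ r ∈ Finset.Ico a (c+1), w (r+1) * (B (r+1) - B r) := by
  induction c, hac using Nat.le_induction with
  | base => simp; nlinarith
  | succ c hac ih =>
    have ih := ih (fun r h1 h2 => hw r h1 (by omega))
    rw [Finset.sum_Ico_succ_top (by omega)]
    have := hw (c+1) (by omega) (by omega)
    have := hB (c+1)
    nlinarith

lemma inv_sin_le (x : ℝ) (h0 : 0 < x) (h1 : x ≤ π / 2) : 1 / Real.sin x ≤ 1 / x + 1 / 2 := by
  have hs : 0 < Real.sin (x/2) := Real.sin_pos_of_pos_of_lt_pi (by linarith) (by linarith [Real.pi_pos])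
  have hc : 0 < Real.cos (x/2) := Real.cos_pos_of_mem_Ioo ⟨by linarith [Real.pi_pos], by linarith [Real.pi_pos]⟩
  have hsc : Real.sin (x/2) ≤ Real.cos (x/2) := by
    rw [← Real.cos_pi_div_two_sub]
    apply Real.cos_le_cos_of_nonneg_of_le_pi <;> linarith [Real.pi_pos]
  have ht : x/2 ≤ Real.tan (x/2) := Real.le_tan (by linarith) (by linarith [Real.pi_pos])
  rw [Real.tan_eq_sin_div_cos, le_div_iff₀ hc] at ht
  have h2 : Real.sin x = 2 * Real.sin (x/2) * Real.cos (x/2) := by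
    rw [← Real.sin_two_mul]; ring_nf
  have h3 := Real.sin_sq_add_cos_sq (x/2)
  rw [h2]
  set s := Real.sin (x/2)
  set c := Real.cos (x/2)
  have : 1 / x + 1 / 2 = (2 + x) / (2 * x) := by field_simp
  rw [this, div_le_div_iff₀ (by positivity) (by positivity)]
  have e1 : x * c * c ≤ 2 * s * c := by nlinarith
  have e2 : x * s * s ≤ x * s * c := by
    have : 0 ≤ x * s := by positivity
    nlinarith
  nlinarith

lemma main_ineq_small (q : ℕ) (h : q = 1 ∨ q = 2 ∨ q = 3) :
    -√(4 * q + 1 : ℝ) < 1 + 2 * ∑ r ∈ Finset.Ico 0 (2*q), Real.cos (2 * π * (r+1:ℕ)^2 / (4 * q + 1)) := by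
  have hpi := Real.pi_pos
  rcases h with rfl | rfl | rfl
  · have h1 : 0 ≤ Real.cos (2 * π / 5) := Real.cos_nonneg_of_mem_Icc ⟨by linarith, by linarith⟩
    have h2 : 0 ≤ Real.cos (2 * π * 4 / 5) := by
      rw [← Real.cos_two_pi_sub]
      exact Real.cos_nonneg_of_mem_Icc ⟨by linarith, by linarith⟩
    norm_num [Finset.sum_range_succ]
    have := Real.sqrt_nonneg 5
    linarith
  · have h1 : 0 ≤ Real.cos (2 * π / 9) := Real.cos_nonneg_of_mem_Icc ⟨by linarith, by linarith⟩
    have h2 : 0 ≤ Real.cos (2 * π * 9 / 9) := by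
      rw [← Real.cos_sub_two_pi]
      exact Real.cos_nonneg_of_mem_Icc ⟨by linarith, by linarith⟩
    have h3 : 0 ≤ Real.cos (2 * π * 16 / 9) := by
      rw [← Real.cos_sub_two_pi, ← Real.cos_sub_two_pi]
      exact Real.cos_nonneg_of_mem_Icc ⟨by linarith, by linarith⟩
    have h4 := Real.neg_one_le_cos (2 * π * 4 / 9)
    have : (3:ℝ) ≤ √9 := Real.le_sqrt_of_sq_le (by norm_num)
    norm_num [Finset.sum_range_succ] at h2 ⊢
    linarith
  · have h1 : 0 ≤ Real.cos (2 * π / 13) := Real.cos_nonneg_of_mem_Icc ⟨by linarith, by linarith⟩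
    have h2 := Real.neg_one_le_cos (2 * π * 4 / 13)
    have h3 := Real.neg_one_le_cos (2 * π * 9 / 13)
    have h4 : 0 ≤ Real.cos (2 * π * 16 / 13) := by
      rw [← Real.cos_sub_two_pi]
      exact Real.cos_nonneg_of_mem_Icc ⟨by linarith, by linarith⟩
    have h5 : 0 ≤ Real.cos (2 * π * 25 / 13) := by
      rw [← Real.cos_sub_two_pi, ← Real.cos_sub_two_pi]
      exact Real.cos_nonneg_of_mem_Icc ⟨by linarith, by linarith⟩
    have h6 : 0 ≤ Real.cos (2 * π * 36 / 13) := by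
      rw [← Real.cos_sub_two_pi, ← Real.cos_sub_two_pi, ← Real.cos_sub_two_pi]
      exact Real.cos_nonneg_of_mem_Icc ⟨by linarith, by linarith⟩
    have : (3.5:ℝ) ≤ √13 := Real.le_sqrt_of_sq_le (by norm_num)
    norm_num [Finset.sum_range_succ]
    linarith

lemma head_sum (m : ℕ) : ∑ r ∈ Finset.Ico 0 m, ((r+1:ℕ):ℝ)^2 = m * (m+1) * (2*m+1) / 6 := by
  induction m with
  | zero => simp
  | succ m ih =>
    rw [Finset.sum_Ico_succ_top (by omega), ih]
    push_cast
    ring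

set_option maxHeartbeats 4000000 in
lemma main_ineq_large (q : ℕ) (h : 4 ≤ q) :
    -√(4 * q + 1 : ℝ) < 1 + 2 * ∑ r ∈ Finset.Ico 0 (2*q), Real.cos (2 * π * (r+1:ℕ)^2 / (4 * q + 1)) := by
  have hpi := Real.pi_pos
  set k : ℝ := 4 * q + 1 with hk
  have hq4 : (4:ℝ) ≤ q := by exact_mod_cast h
  have hk0 : 0 < k := by linarith
  obtain ⟨m, hm⟩ : ∃ m, m = Nat.sqrt q := ⟨_, rfl⟩
  have hm1 : m * m ≤ q := hm ▸ Nat.sqrt_le q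
  have hm2 : q < (m+1) * (m+1) := hm ▸ Nat.lt_succ_sqrt q
  have hm3 : 2 ≤ m := by
    by_contra hh
    have : m ≤ 1 := by omega
    have : (m+1)*(m+1) ≤ 2 * 2 := Nat.mul_le_mul (by omega) (by omega)
    omega
  have hmq : m + 1 ≤ q := by nlinarith
  obtain ⟨s, hs⟩ : ∃ s, s = Nat.sqrt (2 * (4 * q + 1)) := ⟨_, rfl⟩
  have hs1 : s * s ≤ 2 * (4 * q + 1) := hs ▸ Nat.sqrt_le _
  have hs2 : 2 * (4 * q + 1) < (s+1) * (s+1) := hs ▸ Nat.lt_succ_sqrt _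
  have hs3 : s + 2 ≤ 2 * q := by
    by_contra hh
    have : (2*q-1)*(2*q-1) ≤ s * s := Nat.mul_le_mul (by omega) (by omega)
    obtain ⟨t, rfl⟩ : ∃ t, q = t + 4 := ⟨q - 4, by omega⟩
    have e : 2 * (t+4) - 1 = 2 * t + 7 := by omega
    rw [e] at this
    nlinarith
  obtain ⟨b, hb⟩ : ∃ b, b = (4 * q + 1 - s - 1) / 2 := ⟨_, rfl⟩
  have hb1 : q + 1 ≤ b := by omega
  have hb2 : b ≤ 2 * q := by omega
  have hb3 : 2 * b + s + 1 ≤ 4 * q + 1 := by omega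
  have hb4 : 4 * q + 1 ≤ 2 * b + s + 2 := by omega
  -- real versions
  have hm1r : (m:ℝ) * m ≤ q := by exact_mod_cast hm1
  have hm2r : (q:ℝ) + 1 ≤ (m+1) * (m+1) := by exact_mod_cast hm2
  have hm3r : (2:ℝ) ≤ m := by exact_mod_cast hm3
  have hmqr : (m:ℝ) + 1 ≤ q := by exact_mod_cast hmq
  have hs1r : (s:ℝ) * s ≤ 2 * k := by rw [hk]; exact_mod_cast hs1
  have hs2r : 2 * k < ((s:ℝ) + 1) * (s + 1) := by rw [hk]; exact_mod_cast hs2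
  have hb1r : (q:ℝ) + 1 ≤ b := by exact_mod_cast hb1
  have hb2r : (b:ℝ) ≤ 2 * q := by exact_mod_cast hb2
  have hb3r : 2 * (b:ℝ) + s + 1 ≤ k := by rw [hk]; exact_mod_cast hb3
  have hb4r : k ≤ 2 * (b:ℝ) + s + 2 := by rw [hk]; exact_mod_cast hb4
  set f : ℕ → ℝ := fun r => Real.cos (2 * π * (r+1:ℕ)^2 / k) with hf
  set w : ℕ → ℝ := fun r => 1 / (2 * Real.sin (2 * π * r / k)) with hw
  set B : ℕ → ℝ := fun r => Real.sin (2 * π * (r * (r + 1)) / k) with hB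
  have hB1 : ∀ r, B r ≤ 1 := fun r => Real.sin_le_one _
  have hB2 : ∀ r, -1 ≤ B r := fun r => Real.neg_one_le_sin _
  have hsin : ∀ r : ℕ, 1 ≤ r → r ≤ 2 * q → 0 < Real.sin (2 * π * r / k) := by
    intro r h1 h2
    have h1r : (1:ℝ) ≤ r := by exact_mod_cast h1
    have h2r : (r:ℝ) ≤ 2 * q := by exact_mod_cast h2
    apply Real.sin_pos_of_pos_of_lt_pi
    · positivity
    · rw [div_lt_iff₀ hk0]
      linarith [mul_lt_mul_of_pos_left (by linarith : 2 * (r:ℝ) < k) hpi]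
  have hfw : ∀ r : ℕ, r + 1 ≤ 2 * q → f r = w (r+1) * (B (r+1) - B r) := by
    intro r h1
    have h2 := hsin (r+1) (by omega) h1
    simp only [hf, hw, hB]
    rw [Real.sin_sub_sin]
    have e1 : (2 * π * (((r+1:ℕ):ℝ) * ((r+1:ℕ) + 1)) / k - 2 * π * ((r:ℝ) * (r + 1)) / k) / 2
      = 2 * π * (r+1:ℕ) / k := by push_cast; field_simp; ring
    have e2 : (2 * π * (((r+1:ℕ):ℝ) * ((r+1:ℕ) + 1)) / k + 2 * π * ((r:ℝ) * (r + 1)) / k) / 2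
      = 2 * π * (r+1:ℕ)^2 / k := by push_cast; field_simp; ring
    rw [e1, e2]
    field_simp
  have hwhalf : ∀ r : ℕ, 1 ≤ r → r ≤ 2 * q → 1 / 2 ≤ w r := by
    intro r h1 h2
    have h3 := hsin r h1 h2
    simp only [hw]
    apply one_div_le_one_div_of_le (by linarith)
    linarith [Real.sin_le_one (2 * π * r / k)]
  -- left weights
  have hwanti : ∀ r, m + 1 ≤ r → r < q - 1 + 1 → w (r+1) ≤ w r := by
    intro r h1 h2
    have h2r : ((r + 1 : ℕ):ℝ) ≤ q := by exact_mod_cast (by omega : r + 1 ≤ q)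
    simp only [hw]
    apply one_div_le_one_div_of_le
    · linarith [hsin r (by omega) (by omega)]
    · have : Real.sin (2 * π * r / k) ≤ Real.sin (2 * π * (r+1:ℕ) / k) := by
        apply Real.sin_le_sin_of_le_of_le_pi_div_two
        · have : 0 ≤ 2 * π * r / k := by positivity
          linarith
        · rw [div_le_iff₀ hk0]
          linarith [mul_le_mul_of_nonneg_left (by linarith : 4 * ((r+1:ℕ):ℝ) ≤ k) hpi.le]
        · gcongr; omega
      linarith
  have hwmono : ∀ r, q + 1 ≤ r → r < b - 1 + 1 → w r ≤ w (r+1) := by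
    intro r h1 h2
    have h1r : (q:ℝ) + 1 ≤ r := by exact_mod_cast h1
    have h2r : ((r + 1 : ℕ):ℝ) ≤ 2 * q := by exact_mod_cast (by omega : r + 1 ≤ 2 * q)
    simp only [hw]
    apply one_div_le_one_div_of_le
    · linarith [hsin (r+1) (by omega) (by omega)]
    · have : Real.sin (2 * π * (r+1:ℕ) / k) ≤ Real.sin (2 * π * r / k) := by
        rw [← Real.sin_pi_sub, ← Real.sin_pi_sub (2 * π * r / k)]
        apply Real.sin_le_sin_of_le_of_le_pi_div_two
        · have : 2 * π * (r+1:ℕ) / k ≤ π := by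
            rw [div_le_iff₀ hk0]
            linarith [mul_le_mul_of_nonneg_left (by linarith : 2 * ((r+1:ℕ):ℝ) ≤ k) hpi.le]
          linarith
        · have : π / 2 ≤ 2 * π * r / k := by
            rw [le_div_iff₀ hk0]
            linarith [mul_le_mul_of_nonneg_left (by linarith : k ≤ 4 * (r:ℝ)) hpi.le]
          linarith
        · have : 2 * π * r / k ≤ 2 * π * (r+1:ℕ) / k := by gcongr; omega
          linarith
      linarith
  have hleft := abel_antitone w B hB2 m (q-1) (by omega)
    (by linarith [hwhalf (m+1) (by omega) (by omega)]) (hB1 m) hwanti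
  have hright := abel_monotone w B hB1 q (b-1) (by omega) hwmono
  rw [show q - 1 + 1 = q by omega] at hleft
  rw [show b - 1 + 1 = b by omega] at hright
  rw [← Finset.sum_congr rfl (fun r hr => hfw r (by rw [Finset.mem_Ico] at hr; omega))] at hleft
  rw [← Finset.sum_congr rfl (fun r hr => hfw r (by rw [Finset.mem_Ico] at hr; omega))] at hright
  have hwq := hwhalf q (by omega) (by omega)
  have hwq1 := hwhalf (q+1) (by omega) (by omega)
  have hwb := hwhalf b (by omega) (by omega)
  set R := √k with hR
  have hR0 : 0 < R := Real.sqrt_pos.mpr hk0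
  have hRR : R * R = k := Real.mul_self_sqrt hk0.le
  have hwa' : 2 * w (m+1) ≤ R / π + 1 / 2 := by
    have h1 := inv_sin_le (2 * π * (m+1:ℕ) / k) (by positivity)
      (by rw [div_le_iff₀ hk0]; push_cast; linarith [mul_le_mul_of_nonneg_left (by linarith : 4 * ((m:ℝ)+1) ≤ k) hpi.le])
    have h2 : 1 / (2 * π * (m+1:ℕ) / k) ≤ R / π := by
      have : R ≤ 2 * (m+1) := by
        apply Real.sqrt_le_iff.mpr; constructor
        · positivity
        · linarith [show (2 * ((m:ℝ)+1))^2 = 4 * ((m+1)*(m+1)) by ring]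
      rw [one_div_div, div_le_div_iff₀ (by positivity) hpi, ← hRR]
      push_cast
      have h3 := mul_le_mul_of_nonneg_left this (by positivity : 0 ≤ R * π)
      linarith
    have h3 : 2 * w (m+1) = 1 / Real.sin (2 * π * (m+1:ℕ) / k) := by
      simp only [hw]; rw [← mul_div_assoc, mul_one, one_div, div_mul_eq_div_div, div_self two_ne_zero, one_div]
    linarith
  have hwb' : 2 * w b ≤ R / (π * √2) + 1 / 2 := by
    have hx : π - 2 * π * b / k = π * (k - 2 * b) / k := by field_simp
    have hj : (s:ℝ) + 1 ≤ k - 2 * b := by linarith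
    have hs0 : (0:ℝ) ≤ s := by positivity
    have h1 := inv_sin_le (π * (k - 2 * b) / k) 
      (by have : 0 < k - 2 * b := by linarith
          positivity)
      (by rw [div_le_iff₀ hk0]; linarith [mul_le_mul_of_nonneg_left (by linarith : k - 2 * (b:ℝ) ≤ k / 2) hpi.le])
    rw [← hx, Real.sin_pi_sub, hx] at h1
    have h2 : 1 / (π * (k - 2 * b) / k) ≤ R / (π * √2) := by
      have : R * √2 ≤ k - 2 * b := by
        rw [hR, ← Real.sqrt_mul hk0.le]
        apply Real.sqrt_le_iff.mpr; constructor
        · linarith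
        · linarith [pow_le_pow_left₀ (by linarith : 0 ≤ (s:ℝ) + 1) hj 2]
      have h4 : 0 < k - 2 * b := by linarith
      rw [one_div_div, div_le_div_iff₀ (by positivity) (by positivity), ← hRR]
      rw [hRR]
      have h3 := mul_le_mul_of_nonneg_left this (by positivity : 0 ≤ R * π)
      have e6 : R * π * (R * √2) = k * (π * √2) := by rw [← hRR]; ring
      linarith
    have h3 : 2 * w b = 1 / Real.sin (2 * π * b / k) := by
      simp only [hw]; rw [← mul_div_assoc, mul_one, one_div, div_mul_eq_div_div, div_self two_ne_zero, one_div]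
    linarith
  have hmid : 1 - 2 * w (m+1) - 2 * w b ≤ ∑ r ∈ Finset.Ico m q, f r + ∑ r ∈ Finset.Ico q b, f r := by
    have := hB1 q
    have := hB2 q
    have := hB2 b
    linarith [mul_nonneg (sub_nonneg.mpr hwq) (by linarith : 0 ≤ 1 + B q), mul_nonneg (sub_nonneg.mpr hwq1) (by linarith : 0 ≤ 1 - B q), mul_nonneg (by linarith : 0 ≤ w b) (by linarith : 0 ≤ 1 + B b)]
  -- tail
  have htail : 0 ≤ ∑ r ∈ Finset.Ico b (2*q), f r := by
    apply Finset.sum_nonneg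
    intro r hr
    rw [Finset.mem_Ico] at hr
    have h1 : (b:ℝ) + 1 ≤ (r+1:ℕ) := by exact_mod_cast (by omega : b + 1 ≤ r + 1)
    have h2 : ((r+1:ℕ):ℝ) ≤ 2 * q := by exact_mod_cast (by omega : r + 1 ≤ 2 * q)
    simp only [hf]
    set x : ℝ := ((r+1:ℕ):ℝ) with hx
    have hj0 : 0 ≤ k - 2 * x := by linarith
    have hj1 : k - 2 * x ≤ s := by linarith
    have hj2 : (k - 2 * x)^2 ≤ 2 * k := by linarith [pow_le_pow_left₀ hj0 hj1 2]
    have e : 2 * π * x ^ 2 / k = (π * (k - 2 * x)^2 / (2 * k) - π / 2)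
        + (((r:ℤ) + 1 - q : ℤ) : ℝ) * (2 * π) := by
      have hq' : (q:ℝ) = (k - 1) / 4 := by rw [hk]; ring
      have hr' : (r:ℝ) = x - 1 := by rw [hx]; push_cast; ring
      push_cast
      rw [hq', hr']
      field_simp
      ring
    rw [e, Real.cos_add_int_mul_two_pi]
    have h3 : 0 ≤ π * (k - 2 * x)^2 / (2 * k) := by positivity
    have h4 : π * (k - 2 * x)^2 / (2 * k) ≤ π := by
      rw [div_le_iff₀ (by positivity)]
      exact mul_le_mul_of_nonneg_left hj2 hpi.le
    exact Real.cos_nonneg_of_mem_Icc ⟨by linarith, by linarith⟩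
  have hhead : 2 / 3 * (m:ℝ) - 2 / 3 ≤ ∑ r ∈ Finset.Ico 0 m, f r := by
    have : ∑ r ∈ Finset.Ico 0 m, (1 - 4 / k * ((r+1:ℕ):ℝ)^2) ≤ ∑ r ∈ Finset.Ico 0 m, f r := by
      apply Finset.sum_le_sum
      intro r hr
      rw [Finset.mem_Ico] at hr
      have h1 : ((r+1:ℕ):ℝ) ≤ m := by exact_mod_cast (by omega : r + 1 ≤ m)
      simp only [hf]
      have h0 : (0:ℝ) ≤ (r+1:ℕ) := by positivity
      set x : ℝ := ((r+1:ℕ):ℝ) with hx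
      have h3 : x ^ 2 ≤ q := by linarith [pow_le_pow_left₀ h0 h1 2]
      have := Real.one_sub_mul_le_cos (x := 2 * π * x ^ 2 / k) (by positivity)
        (by rw [div_le_iff₀ hk0]; linarith [mul_le_mul_of_nonneg_left (by linarith : 4 * x ^ 2 ≤ k) hpi.le])
      have e : 2 / π * (2 * π * x ^ 2 / k) = 4 / k * x ^ 2 := by field_simp; ring
      linarith
    rw [Finset.sum_sub_distrib, ← Finset.mul_sum, head_sum] at this
    simp only [Finset.sum_const, Nat.card_Ico, nsmul_eq_mul, mul_one, Nat.sub_zero] at this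
    have h4 : 4 / k * ((m:ℝ) * (m+1) * (2*m+1) / 6) ≤ m / 3 + 2 / 3 := by
      rw [div_mul_eq_mul_div, div_le_iff₀ hk0]
      have e7 := mul_le_mul_of_nonneg_left (by linarith : 4 * ((m:ℝ) * m) ≤ k) (by positivity : 0 ≤ (m:ℝ) / 3 + 2 / 3)
      have e8 : 0 ≤ (m:ℝ) * (m - 1) := mul_nonneg (by linarith) (by linarith)
      linarith
    linarith
  have hRm : R ≤ 2 * (m+1) := by
    apply Real.sqrt_le_iff.mpr; constructor
    · positivity
    · linarith [show (2 * ((m:ℝ)+1))^2 = 4 * ((m+1)*(m+1)) by ring]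
  have hpi2 : R / π ≤ R * 0.32 := by
    rw [div_le_iff₀ hpi]; linarith [mul_le_mul_of_nonneg_left Real.pi_gt_d2.le hR0.le]
  have hpi3 : R / (π * √2) ≤ R * 0.23 := by
    have : (1.41:ℝ) ≤ √2 := Real.le_sqrt_of_sq_le (by norm_num)
    have h5 : (3.14 * 1.41 : ℝ) ≤ π * √2 := by
      apply mul_le_mul Real.pi_gt_d2.le this (by norm_num) hpi.le
    rw [div_le_iff₀ (by positivity)]; linarith [mul_le_mul_of_nonneg_left h5 hR0.le]
  rw [← Finset.sum_Ico_consecutive f (Nat.zero_le m) (by omega : m ≤ 2 * q),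
    ← Finset.sum_Ico_consecutive f (by omega : m ≤ q) (by omega : q ≤ 2 * q),
    ← Finset.sum_Ico_consecutive f (by omega : q ≤ b) hb2]
  linarith

lemma gauss_eq (p : ℕ) [Fact p.Prime] (hp : p % 4 = 1) :
    ∑ k ∈ Finset.range p, (legendreSym p k : ℂ) * Complex.exp (2 * Real.pi * Complex.I * k / p)
     = gaussSum ((quadraticChar (ZMod p)).ringHomComp (Int.castRingHom ℂ)) ZMod.stdAddChar := by
  have hp0 : p ≠ 0 := by omega
  rw [gaussSum]
  symm
  apply Finset.sum_bij' (i := fun (x : ZMod p) _ => x.val) (j := fun k _ => (k : ZMod p))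
  · intro x _; simpa using x.val_lt
  · intro k _; simp
  · intro x _; simp
  · intro k hk; rw [ZMod.val_natCast]; exact Nat.mod_eq_of_lt (Finset.mem_range.mp hk)
  · intro x _
    have := ZMod.stdAddChar_coe (N := p) (x.val : ℤ)
    simp only [Int.cast_natCast, ZMod.natCast_zmod_val] at this
    rw [this]
    simp [legendreSym]

lemma ringChar_ne (p : ℕ) [Fact p.Prime] (hp : p % 4 = 1) : ringChar (ZMod p) ≠ 2 := by
  rw [ZMod.ringChar_zmod_n]; omega

lemma gauss_sq (p : ℕ) [Fact p.Prime] (hp : p % 4 = 1) :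
    gaussSum ((quadraticChar (ZMod p)).ringHomComp (Int.castRingHom ℂ)) ZMod.stdAddChar ^ 2 = p := by
  have hr := ringChar_ne p hp
  rw [gaussSum_sq]
  · rw [MulChar.ringHomComp_apply, quadraticChar_neg_one hr, ZMod.card,
      ZMod.χ₄_nat_one_mod_four hp]
    simp
  · intro h
    obtain ⟨a, ha⟩ := quadraticChar_exists_neg_one' hr
    have := congrArg (fun c => c (a : ZMod p)) h
    simp only [MulChar.ringHomComp_apply, ha, MulChar.one_apply_coe] at this
    norm_num at this
  · exact (quadraticChar_isQuadratic (ZMod p)).comp _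
  · exact ZMod.isPrimitive_stdAddChar p

lemma gauss_eq_sum_sq (p : ℕ) [Fact p.Prime] (hp : p % 4 = 1) :
    gaussSum ((quadraticChar (ZMod p)).ringHomComp (Int.castRingHom ℂ)) ZMod.stdAddChar
      = ∑ x : ZMod p, (ZMod.stdAddChar (x ^ 2) : ℂ) := by
  have hr := ringChar_ne p hp
  rw [← Finset.sum_fiberwise (s := Finset.univ) (g := fun x : ZMod p => x ^ 2)]
  have h1 : ∀ y : ZMod p, ∑ x with x ^ 2 = y, (ZMod.stdAddChar (x ^ 2) : ℂ)
      = ((quadraticChar (ZMod p) y : ℤ) : ℂ) * ZMod.stdAddChar y + ZMod.stdAddChar y := by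
    intro y
    have h2 := quadraticChar_card_sqrts hr y
    rw [Finset.sum_congr rfl (g := fun _ => (ZMod.stdAddChar y : ℂ))
      (fun x hx => by rw [(Finset.mem_filter.mp hx).2])]
    rw [Finset.sum_const, nsmul_eq_mul]
    have h3 : {x : ZMod p | x ^ 2 = y}.toFinset = ({x | x ^ 2 = y} : Finset (ZMod p)) := by
      ext; simp
    rw [h3] at h2
    have h4 : ((#({x | x ^ 2 = y} : Finset (ZMod p)) : ℤ) : ℂ) = ((quadraticChar (ZMod p) y + 1 : ℤ) : ℂ) := by
      rw [h2]
    push_cast at h4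
    rw [h4]; ring
  rw [Finset.sum_congr rfl (fun y _ => h1 y), Finset.sum_add_distrib]
  have h5 : ∑ y : ZMod p, (ZMod.stdAddChar y : ℂ) = 0 := by
    apply AddChar.sum_eq_zero_of_ne_one
    intro h
    have := ZMod.injective_stdAddChar (N := p) (a₁ := 1) (a₂ := 0) (by simp [h])
    exact one_ne_zero this
  rw [h5, add_zero, gaussSum]
  simp

lemma re_sum_sq (p q : ℕ) [Fact p.Prime] (hp : p = 4 * q + 1) :
    (∑ x : ZMod p, (ZMod.stdAddChar (x ^ 2) : ℂ)).re =
     1 + 2 * ∑ r ∈ Finset.Ico 0 (2*q), Real.cos (2 * π * (r+1:ℕ)^2 / (4 * q + 1)) := by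
  have hp' : (p:ℝ) = 4 * q + 1 := by rw [hp]; push_cast; ring
  have hk0 : (4 * q + 1 : ℝ) ≠ 0 := by positivity
  have h1 : ∑ x : ZMod p, (ZMod.stdAddChar (x ^ 2) : ℂ) =
      ∑ k ∈ Finset.range p, (ZMod.stdAddChar ((k : ZMod p) ^ 2) : ℂ) := by
    apply Finset.sum_bij' (i := fun (x : ZMod p) _ => x.val) (j := fun k _ => (k : ZMod p))
    · intro x _; simpa using x.val_lt
    · intro k _; simp
    · intro x _; simp
    · intro k hk; rw [ZMod.val_natCast]; exact Nat.mod_eq_of_lt (Finset.mem_range.mp hk)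
    · intro x _; simp
  have h2 : ∀ k : ℕ, (ZMod.stdAddChar ((k : ZMod p) ^ 2) : ℂ).re
      = Real.cos (2 * π * k ^ 2 / (4 * q + 1)) := by
    intro k
    have := ZMod.stdAddChar_coe (N := p) ((k : ℤ)^2)
    push_cast at this
    rw [this, ← hp']
    have e : 2 * (π:ℂ) * I * (k:ℂ)^2 / p = ((2 * π * k ^ 2 / p : ℝ) : ℂ) * I := by push_cast; ring
    rw [e, Complex.exp_ofReal_mul_I_re]
  rw [h1, Complex.re_sum, Finset.sum_congr rfl (fun k _ => h2 k)]
  set f : ℕ → ℝ := fun r => Real.cos (2 * π * r^2 / (4 * q + 1)) with hf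
  have h3 : ∑ k ∈ Finset.range p, f k = f 0 + ∑ r ∈ Finset.range (4 * q), f (r+1) := by
    rw [hp, Finset.sum_range_succ']; ring
  have h4 : ∑ r ∈ Finset.range (4 * q), f (r+1) =
     ∑ r ∈ Finset.range (2 * q), f (r+1) + ∑ r ∈ Finset.range (2 * q), f (r+1) := by
    rw [show 4 * q = 2 * q + 2 * q by ring, Finset.sum_range_add]
    congr 1
    rw [← Finset.sum_range_reflect]
    apply Finset.sum_congr rfl
    intro r hr
    rw [Finset.mem_range] at hr
    have e0 : 2 * q + (2 * q - 1 - r) + 1 = 4 * q - r := by omega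
    rw [e0]
    simp only [hf]
    rw [Nat.cast_sub (by omega)]
    push_cast
    have e : 2 * π * ((4 * q : ℝ) - r)^2 / (4 * q + 1) = 2 * π * ((r:ℝ)+1)^2 / (4 * q + 1)
      + ((4 * q + 1 - 2 * (r + 1) : ℤ) : ℝ) * (2 * π) := by
      push_cast; field_simp; ring
    rw [e, Real.cos_add_int_mul_two_pi]
  change ∑ k ∈ Finset.range p, f k = 1 + 2 * ∑ r ∈ Finset.Ico 0 (2*q), f (r+1)
  rw [h3, h4, Nat.Ico_zero_eq_range]
  simp [hf]; ring

theorem gaussSum_legendreSym_one_mod_four (p : ℕ) [Fact p.Prime] (hp : p % 4 = 1) :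
    ∑ k ∈ Finset.range p, (legendreSym p k : ℂ) * Complex.exp (2 * Real.pi * Complex.I * k / p)
      = (Real.sqrt p : ℂ) := by
  have hp2 : 2 ≤ p := (Fact.out : p.Prime).two_le
  obtain ⟨q, hq⟩ : ∃ q, p = 4 * q + 1 := ⟨p / 4, by omega⟩
  have hq1 : 1 ≤ q := by omega
  rw [gauss_eq p hp]
  have hsq := gauss_sq p hp
  have hre := re_sum_sq p q hq
  rw [← gauss_eq_sum_sq p hp] at hre
  have hin : -√(4 * q + 1 : ℝ) < 1 + 2 * ∑ r ∈ Finset.Ico 0 (2*q),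
      Real.cos (2 * π * (r+1:ℕ)^2 / (4 * q + 1)) := by
    by_cases h : 4 ≤ q
    · exact main_ineq_large q h
    · exact main_ineq_small q (by omega)
  have hp' : (4 * q + 1 : ℝ) = (p:ℝ) := by rw [hq]; push_cast; ring
  rw [← hre, hp'] at hin
  have h1 : ((√(p:ℝ) : ℝ) : ℂ) ^ 2 = p := by
    rw [← Complex.ofReal_pow, Real.sq_sqrt (by positivity)]; simp
  rw [← h1] at hsq
  rcases sq_eq_sq_iff_eq_or_eq_neg.mp hsq with h2 | h2
  · exact h2
  · rw [h2] at hin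
    simp at hin
end

section
/- For an odd prime p with p ≡ 3 mod 4, the quadratic Gauss sum of the Legendre symbol mod p equals i√p. -/
open Complex Finset Real

open Polynomial in
theorem aux_iter {R : Type*} [CommRing R] (n : ℕ) (g : R[X]) :
    ((fun f : R[X] => X * derivative f)^[n] ((X - 1) ^ n * g)).eval 1 = n.factorial * g.eval 1 := by
  induction n generalizing g with
  | zero => simp
  | succ n ih =>
    rw [Function.iterate_succ_apply]
    have : X * derivative ((X - 1) ^ (n+1) * g)
        = (X-1)^n * (X * ((n+1 : R[X]) * g + (X-1) * derivative g)) := by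
      simp [derivative_mul, derivative_pow]
      ring
    simp only [this]
    rw [ih]
    simp [Nat.factorial_succ]
    ring

open Polynomial in
theorem aux_lin {R : Type*} [CommRing R] (n p : ℕ) (c : ℕ → R) :
    ((fun f : R[X] => X * derivative f)^[n] (∑ j ∈ range p, C (c j) * X ^ j)).eval 1
      = ∑ j ∈ range p, c j * (j:R)^n := by
  have : (fun f : R[X] => X * derivative f)^[n] (∑ j ∈ range p, C (c j) * X ^ j)
    = ∑ j ∈ range p, C (c j * (j:R)^n) * X ^ j := by
    induction n with
    | zero => simp
    | succ n ih =>
      rw [Function.iterate_succ_apply', ih]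
      simp only [derivative_sum, mul_sum]
      refine sum_congr rfl fun j _ => ?_
      rcases j with _ | j
      · rw [derivative_C_mul_X_pow]
        simp
      · simp [derivative_mul, derivative_pow]
        ring
  rw [this]
  simp [eval_finsetSum]

open Polynomial in
theorem aux_modp (p : ℕ) [Fact p.Prime] (m : ℕ) (hm : p = 2 * m + 1) (hp : p % 4 = 3)
    (h : cyclotomic p (ZMod p) ∣ (∑ j ∈ range p, C ((legendreSym p j : ℤ) : ZMod p) * X ^ j)
      - ∏ k ∈ range m, X ^ (m * (k+1)) * (X ^ (k+1) - 1)) : False := by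
  have hprime : p.Prime := Fact.out
  have hc : cyclotomic p (ZMod p) = (X - 1) ^ (p - 1) := by
    have h1 := cyclotomic_prime_mul_X_sub_one (ZMod p) p
    have h2 : (X - 1 : (ZMod p)[X]) ≠ 0 := by
      simpa using X_sub_C_ne_zero (1 : ZMod p)
    apply mul_right_cancel₀ h2
    rw [h1, ← pow_succ, Nat.sub_add_cancel hprime.one_le, sub_pow_char]
    simp
  have hm1 : 1 ≤ m := by have := hprime.two_le; omega
  have hprod : ∏ k ∈ range m, (X : (ZMod p)[X]) ^ (m * (k+1)) * (X ^ (k+1) - 1)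
      = (X - 1) ^ m * ∏ k ∈ range m, (X ^ (m * (k+1)) * ∑ i ∈ range (k+1), X ^ i) := by
    have : ((X : (ZMod p)[X]) - 1) ^ m = ∏ k ∈ range m, (X - 1) := by simp
    rw [this, ← prod_mul_distrib]
    refine prod_congr rfl fun k _ => ?_
    rw [← geom_sum_mul]; ring
  obtain ⟨q, hq⟩ := h
  rw [hc, hprod, show p - 1 = m + m by omega, pow_add, sub_eq_iff_eq_add, mul_assoc, ← mul_add] at hq
  have e := congrArg (fun f => ((fun f : (ZMod p)[X] => X * derivative f)^[m] f).eval 1) hq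
  simp only [aux_iter, aux_lin] at e
  have l : ∑ j ∈ range p, ((legendreSym p j : ℤ) : ZMod p) * (j : ZMod p) ^ m = -1 := by
    have : ∀ j ∈ range p, ((legendreSym p j : ℤ) : ZMod p) * (j : ZMod p) ^ m
        = if j = 0 then 0 else 1 := by
      intro j hj
      rw [legendreSym.eq_pow, show p / 2 = m by omega]
      split_ifs with h0
      · subst h0; simp; omega
      · push_cast
        rw [← pow_add, show m + m = p - 1 by omega, ZMod.pow_card_sub_one_eq_one]
        intro hz
        rw [ZMod.natCast_eq_zero_iff] at hz
        exact absurd (Nat.le_of_dvd (Nat.pos_of_ne_zero h0) hz) (by simpa using hj)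
    have hr : range p = range (2 * m + 1) := by rw [← hm]
    have h3 : ((2 * m + 1 : ℕ) : ZMod p) = 0 := by
      rw [ZMod.natCast_eq_zero_iff, ← hm]
    rw [sum_congr rfl this, hr, sum_range_succ']
    push_cast at h3
    simp
    linear_combination h3
  rw [l] at e
  have r : (∏ k ∈ range m, ((X : (ZMod p)[X]) ^ (m * (k+1)) * ∑ i ∈ range (k+1), X ^ i)).eval 1
      = (m.factorial : ZMod p) := by
    rw [eval_prod, ← prod_range_add_one_eq_factorial]
    push_cast
    simp [eval_finsetSum]
  have hz : (((X : (ZMod p)[X]) - 1) ^ m * q).eval 1 = 0 := by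
    simp; left; omega
  rw [eval_add, hz, r, zero_add] at e
  exact ZMod.mod_four_ne_three_of_sq_eq_neg_one (y := (m.factorial : ZMod p)) (by rw [e]; ring) hp

theorem aux_sq (p : ℕ) [Fact p.Prime] (hp : p % 4 = 3) :
    (∑ k ∈ Finset.range p, (legendreSym p k : ℂ) * Complex.exp (2 * Real.pi * Complex.I * k / p))^2
      = - p := by
  have h2 : ringChar (ZMod p) ≠ 2 := by
    rw [ZMod.ringChar_zmod_n]; rintro rfl; omega
  have := gaussSum_sq (χ := (quadraticChar (ZMod p)).ringHomComp (Int.castRingHom ℂ))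
    ((MulChar.ringHomComp_ne_one_iff (RingHom.injective_int _)).mpr (quadraticChar_ne_one h2))
    ((quadraticChar_isQuadratic _).comp _) (ZMod.isPrimitive_stdAddChar p)
  have e : gaussSum ((quadraticChar (ZMod p)).ringHomComp (Int.castRingHom ℂ)) (ZMod.stdAddChar)
      = ∑ k ∈ Finset.range p, (legendreSym p k : ℂ) * Complex.exp (2 * Real.pi * Complex.I * k / p) := by
    unfold gaussSum
    symm
    refine sum_bij (fun k _ => (k : ZMod p)) (by simp) ?_ ?_ ?_
    · intro a ha b hb hab
      rw [ZMod.natCast_eq_natCast_iff'] at hab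
      rwa [Nat.mod_eq_of_lt (by simpa using ha), Nat.mod_eq_of_lt (by simpa using hb)] at hab
    · intro b _
      exact ⟨b.val, by simpa using ZMod.val_lt b, by simp⟩
    · intro k _
      have := ZMod.stdAddChar_coe (N := p) (k : ℤ)
      push_cast at this
      rw [this]
      simp [legendreSym]
  rw [← e, this]
  simp [quadraticChar_neg_one h2, ZMod.card, ZMod.χ₄_nat_three_mod_four hp]

theorem aux_norm (p m : ℕ) (hm : p = 2 * m + 1) (ζ : ℂ) (h : IsPrimitiveRoot ζ p) :
    (∏ k ∈ range m, ‖ζ ^ (k+1) - 1‖) = Real.sqrt p := by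
  have hn : ‖ζ‖ = 1 := h.norm'_eq_one (by omega)
  have h0 : ζ ≠ 0 := by rintro rfl; simp at hn
  subst hm
  have := congrArg norm h.prod_one_sub_pow_eq_order
  rw [norm_prod, two_mul, prod_range_add] at this
  rw [eq_comm, Real.sqrt_eq_iff_mul_self_eq (by positivity) (by positivity)]
  have h3 : ∏ x ∈ range m, ‖1 - ζ ^ (m + x + 1)‖ = ∏ k ∈ range m, ‖ζ ^ (k+1) - 1‖ := by
    rw [← prod_range_reflect]
    refine prod_congr rfl fun k hk => ?_
    have hk := mem_range.1 hk
    have : ζ ^ (k+1) * (1 - ζ ^ (m + (m - 1 - k) + 1)) = ζ ^ (k+1) - 1 := by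
      rw [mul_sub, ← pow_add, show k + 1 + (m + (m - 1 - k) + 1) = 2 * m + 1 by omega, h.pow_eq_one]
      simp
    rw [← this, norm_mul, norm_pow, hn]; simp
  rw [h3] at this
  simp only [norm_sub_rev (1:ℂ)] at this
  rw [this]
  norm_cast
  simp [two_mul]

theorem aux_sign (t : ℕ) : ∏ k ∈ range (2 * t + 1), ((-1 : ℂ) ^ (k+1) * I) = - I := by
  induction t with
  | zero => simp
  | succ t ih =>
    rw [show 2 * (t+1) + 1 = 2 * t + 1 + 1 + 1 by ring, prod_range_succ, prod_range_succ, ih]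
    have : (-1 : ℂ) ^ (2 * t) = 1 := by simp
    simp only [pow_succ, this]
    linear_combination I * I_mul_I

theorem aux_P (p t : ℕ) (hm : p = 2 * (2 * t + 1) + 1) (ζ : ℂ) (hζ : ζ = Complex.exp (2 * Real.pi * I / p)) :
    ∏ k ∈ range (2*t+1), ζ ^ ((2*t+1) * (k+1)) * (ζ ^ (k+1) - 1) = - (I * (Real.sqrt p : ℂ)) := by
  have hp0 : (p:ℂ) ≠ 0 := by norm_cast; omega
  have hprim : IsPrimitiveRoot ζ p := hζ ▸ Complex.isPrimitiveRoot_exp p (by omega)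
  rw [← aux_norm p (2*t+1) hm ζ hprim, ← neg_mul, ← aux_sign t, ofReal_prod, ← prod_mul_distrib]
  refine prod_congr rfl fun k hk => ?_
  have hk := mem_range.1 hk
  set s : ℝ := Real.sin (Real.pi * (k+1) / p) with hs
  have hs0 : 0 ≤ s := by
    apply Real.sin_nonneg_of_nonneg_of_le_pi (by positivity)
    rw [div_le_iff₀ (by norm_cast; omega)]
    gcongr
    norm_cast; omega
  have e : ζ ^ (k+1) - 1 = Complex.exp (Real.pi * I * (k+1) / p) * (2 * I * s) := by
    rw [hs, ofReal_sin, Complex.sin, hζ, ← Complex.exp_nat_mul]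
    push_cast
    have h1 : Complex.exp ((k+1) * (2 * Real.pi * I / p)) = Complex.exp (Real.pi * I * (k+1) / p) * Complex.exp (Real.pi * I * (k+1) / p) := by
      rw [← Complex.exp_add]; congr 1; ring
    have h2 : Complex.exp (Real.pi * I * (k+1) / p) * Complex.exp (-(Real.pi * I * (k+1) / p)) = 1 := by
      rw [← Complex.exp_add]; simp
    rw [h1, show -((Real.pi:ℂ) * (k+1) / p) * I = -(Real.pi * I * (k+1) / p) by ring,
      show ((Real.pi:ℂ) * (k+1) / p) * I = (Real.pi * I * (k+1) / p) by ring]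
    linear_combination h2 + (Complex.exp (Real.pi * I * (k+1) / p) * (Complex.exp (-(Real.pi * I * (k+1) / p)) - Complex.exp ((Real.pi * I * (k+1) / p)))) * (-I_mul_I)
  have n : ‖ζ ^ (k+1) - 1‖ = 2 * s := by
    rw [e, show (Real.pi * I * (k+1) / p : ℂ) = ((Real.pi * (k+1) / p : ℝ) : ℂ) * I by push_cast; ring,
      norm_mul, norm_exp_ofReal_mul_I]
    simp [abs_of_nonneg hs0]
  have e2 : ζ ^ ((2*t+1) * (k+1)) * Complex.exp (Real.pi * I * (k+1) / p) = (-1) ^ (k+1) := by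
    rw [hζ, ← Complex.exp_nat_mul, ← Complex.exp_add, ← Complex.exp_pi_mul_I, ← Complex.exp_nat_mul]
    congr 1
    field_simp
    rw [hm]; push_cast; ring
  rw [n, e, ← mul_assoc, e2]
  push_cast; ring

theorem gaussSum_legendreSym_three_mod_four (p : ℕ) [Fact p.Prime] (hp : p % 4 = 3) :
    ∑ k ∈ Finset.range p, (legendreSym p k : ℂ) * Complex.exp (2 * Real.pi * Complex.I * k / p)
      = Complex.I * (Real.sqrt p : ℂ) := by
  have h := aux_sq p hp
  obtain ⟨t, ht⟩ : ∃ t, p = 2 * (2 * t + 1) + 1 := ⟨p / 4, by omega⟩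
  have hs : (I * (Real.sqrt p : ℂ))^2 = -p := by
    rw [mul_pow, I_sq, ← ofReal_pow, Real.sq_sqrt (by positivity)]; simp
  rw [← hs] at h
  rcases sq_eq_sq_iff_eq_or_eq_neg.1 h with h | h
  · exact h
  exfalso
  have hprim := Complex.isPrimitiveRoot_exp p (by omega)
  rw [← aux_P p t ht _ rfl] at h
  apply aux_modp p (2*t+1) ht hp
  set ζ := Complex.exp (2 * Real.pi * I / p) with hζ
  have d : Polynomial.cyclotomic p ℤ ∣ (∑ j ∈ range p, Polynomial.C (legendreSym p j) * Polynomial.X ^ j)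
      - ∏ k ∈ range (2*t+1), Polynomial.X ^ ((2*t+1) * (k+1)) * (Polynomial.X ^ (k+1) - 1) := by
    rw [Polynomial.cyclotomic_eq_minpoly hprim (by omega)]
    apply minpoly.isIntegrallyClosed_dvd (hprim.isIntegral (by omega))
    simp only [map_sub, map_sum, map_prod, map_mul, map_pow, Polynomial.aeval_X, Polynomial.aeval_C, map_one]
    rw [sub_eq_zero, ← h]
    refine sum_congr rfl fun k _ => ?_
    rw [hζ, ← Complex.exp_nat_mul]
    simp
    left; congr 1; ring
  have := map_dvd (Polynomial.mapRingHom (Int.castRingHom (ZMod p))) d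
  simpa [Polynomial.map_sum, Polynomial.map_prod] using this
end
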